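/- Let ψ : ℝ → ℝⁿ be continuous. If there exist time instants 0 ≤ t₁ ≤ … ≤ tₙ such that the matrix with columns ψ(t₁), …, ψ(tₙ) has rank n (identifiability), then ψ is interval exciting: for every t_d > tₙ there exists C_d > 0 such that ∫₀^{t_d} ψ(s)ψ(s)ᵀ ds ≥ C_d Iₙ in the sense of quadratic forms (vᵀ(∫₀^{t_d} ψψᵀ)v ≥ C_d |v|² for all v ∈ ℝⁿ). -/

import Mathlib

open Matrix

/-- Observability Gramian `W(0,T) = ∫₀ᵀ ψ(τ)ψ(τ)ᵀ dτ` (entrywise). -/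
noncomputable def obsGram (n : ℕ) (ψ : ℝ → Fin n → ℝ) (T : ℝ) :
    Matrix (Fin n) (Fin n) ℝ :=
  Matrix.of fun i j => ∫ τ in (0:ℝ)..T, ψ τ i * ψ τ j

/-- Sample matrix whose `j`-th column is `ψ (t j)`. -/
def sampleMatrix (n : ℕ) (ψ : ℝ → Fin n → ℝ) (t : Fin n → ℝ) :
    Matrix (Fin n) (Fin n) ℝ :=
  Matrix.of fun i j => ψ (t j) i

/-- The quadratic form of the Gramian is the energy `∫₀ᵀ (v ⬝ᵥ ψ τ)² dτ`. -/
theorem dotProduct_obsGram_mulVec {n : ℕ} {ψ : ℝ → Fin n → ℝ} (hψ : Continuous ψ)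
    (T : ℝ) (v : Fin n → ℝ) :
    v ⬝ᵥ (obsGram n ψ T *ᵥ v) = ∫ τ in (0:ℝ)..T, (v ⬝ᵥ ψ τ) ^ 2 := by
  have hc (i : Fin n) : Continuous fun τ => ψ τ i := (continuous_apply i).comp hψ
  have hsq (τ : ℝ) : (v ⬝ᵥ ψ τ) ^ 2 = ∑ i, ∑ j, v i * v j * (ψ τ i * ψ τ j) := by
    rw [sq, dotProduct, Finset.sum_mul_sum]
    exact Finset.sum_congr rfl fun i _ => Finset.sum_congr rfl fun j _ => by ring
  simp_rw [hsq]
  rw [intervalIntegral.integral_finsetSum fun i _ => Continuous.intervalIntegrable (by fun_prop) _ _]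
  refine Finset.sum_congr rfl fun i _ => ?_
  rw [intervalIntegral.integral_finsetSum fun j _ => Continuous.intervalIntegrable (by fun_prop) _ _,
    mulVec, dotProduct, Finset.mul_sum]
  refine Finset.sum_congr rfl fun j _ => ?_
  rw [intervalIntegral.integral_const_mul, obsGram, of_apply]
  ring

/-- A nonzero vector is not orthogonal to all columns of a sample matrix of full rank. -/
theorem exists_dotProduct_sample_ne_zero {n : ℕ} {ψ : ℝ → Fin n → ℝ} {t : Fin n → ℝ}
    (hrank : (sampleMatrix n ψ t).rank = n) {v : Fin n → ℝ} (hv : v ≠ 0) :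
    ∃ j, v ⬝ᵥ ψ (t j) ≠ 0 := by
  by_contra! h
  have hunit : IsUnit (sampleMatrix n ψ t) := by
    rw [← linearIndependent_rows_iff_isUnit, linearIndependent_iff_card_eq_finrank_span,
      Fintype.card_fin, Set.finrank, ← rank_eq_finrank_span_row, hrank]
  refine hv (vecMul_injective_of_isUnit hunit ?_)
  simp only [zero_vecMul]
  exact funext h

/-- A quadratic form that is positive off the origin is bounded below by a positive multiple of
the squared Euclidean norm. -/
theorem exists_mul_dotProduct_le_of_pos {ι : Type*} [Fintype ι] (A : Matrix ι ι ℝ)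
    (hA : ∀ v, v ≠ 0 → 0 < v ⬝ᵥ (A *ᵥ v)) :
    ∃ C > (0:ℝ), ∀ v, C * (v ⬝ᵥ v) ≤ v ⬝ᵥ (A *ᵥ v) := by
  have hne {u : ι → ℝ} (hu : u ∈ Metric.sphere (0 : ι → ℝ) 1) : u ≠ 0 :=
    ne_zero_of_mem_unit_sphere ⟨u, hu⟩
  have hpos {u : ι → ℝ} (hu : u ≠ 0) : 0 < u ⬝ᵥ u :=
    lt_of_le_of_ne (Finset.sum_nonneg fun i _ => mul_self_nonneg (u i))
      (Ne.symm (dotProduct_self_eq_zero.not.mpr hu))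
  have hcont : ContinuousOn (fun u : ι → ℝ => u ⬝ᵥ (A *ᵥ u) / (u ⬝ᵥ u))
      (Metric.sphere 0 1) :=
    ContinuousOn.div
      (continuous_id.dotProduct (continuous_const.matrix_mulVec continuous_id)).continuousOn
      (continuous_id.dotProduct continuous_id).continuousOn
      fun u hu => (hpos (hne hu)).ne'
  obtain ⟨C, hC, hle⟩ := (isCompact_sphere (0 : ι → ℝ) 1).exists_forall_le' hcont
    fun u hu => div_pos (hA u (hne hu)) (hpos (hne hu))
  refine ⟨C, hC, fun v => ?_⟩
  rcases eq_or_ne v 0 with rfl | hv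
  · simp
  have hu : ‖v‖⁻¹ • v ∈ Metric.sphere (0 : ι → ℝ) 1 := by
    simp [norm_smul, hv]
  have h := hle _ hu
  simp only [mulVec_smul, smul_dotProduct, dotProduct_smul, smul_eq_mul] at h
  have hn : ‖v‖⁻¹ ≠ 0 := inv_ne_zero (norm_ne_zero_iff.mpr hv)
  rw [mul_div_mul_left _ _ hn, mul_div_mul_left _ _ hn] at h
  exact (le_div_iff₀ (hpos hv)).mp h

/-- Identifiability implies interval excitation: if some sample matrix at times
`0 ≤ t₁ ≤ … ≤ tₙ` has full rank, then for every `t_d > tₙ` there is `C_d > 0`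
with `∫₀^{t_d} ψψᵀ ≥ C_d Iₙ` as quadratic forms. -/
theorem identifiability_implies_interval_excitation (n : ℕ) (hn : 1 ≤ n)
    (ψ : ℝ → Fin n → ℝ) (hψ : Continuous ψ)
    (t : Fin n → ℝ) (ht0 : ∀ i, 0 ≤ t i) (htmono : Monotone t)
    (hrank : (sampleMatrix n ψ t).rank = n) :
    ∀ td : ℝ, (∀ i, t i < td) →
      ∃ Cd > (0:ℝ), ∀ v : Fin n → ℝ,
        Cd * (v ⬝ᵥ v) ≤ v ⬝ᵥ (obsGram n ψ td *ᵥ v) := by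
  intro td htd
  have htd0 : 0 < td := (ht0 ⟨0, hn⟩).trans_lt (htd ⟨0, hn⟩)
  refine exists_mul_dotProduct_le_of_pos _ fun v hv => ?_
  obtain ⟨j, hj⟩ := exists_dotProduct_sample_ne_zero hrank hv
  rw [dotProduct_obsGram_mulVec hψ]
  exact intervalIntegral.integral_pos htd0 (by fun_prop) (fun _ _ => sq_nonneg _)
    ⟨t j, ⟨ht0 j, (htd j).le⟩, by positivity⟩
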